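/- Let A and B be measurable spaces. For each n ∈ ℕ let κₙ and λₙ be sub-probability kernels from (Fin n → A) to B that are symmetric, i.e. κₙ(x ∘ σ) = κₙ(x) and λₙ(x ∘ σ) = λₙ(x) for every x : Fin n → A and every permutation σ of Fin n. Assume that for every finitely supported sub-probability measure μ on A, the measures Σₙ ((μ^{⊗n}).bind κₙ) and Σₙ ((μ^{⊗n}).bind λₙ) are sub-probability measures and are equal. Then κₙ(x) = λₙ(x) for every n ∈ ℕ and every x : Fin n → A. -/

import Mathlib

open MeasureTheory
open scoped ENNReal

/-- A finitely supported sub-probability measure: a sub-convex combination of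
finitely many Dirac measures. -/
def IsFinitelySupportedSubProb {A : Type*} [MeasurableSpace A] (μ : Measure A) : Prop :=
  ∃ (k : ℕ) (x : Fin k → A) (r : Fin k → ℝ≥0∞), (∑ i, r i) ≤ 1 ∧
    μ = ∑ i, r i • Measure.dirac (x i)

lemma aux_pi {A : Type*} [MeasurableSpace A] {k : ℕ} (m : ℕ) (x : Fin k → A) (r : Fin k → ℝ≥0∞)
    (hr : ∑ i, r i ≤ 1) :
    (Measure.pi fun _ : Fin m => (∑ a, r a • Measure.dirac (x a))) =
      ∑ i : Fin m → Fin k, (∏ j, r (i j)) • Measure.dirac (x ∘ i) := by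
  classical
  have : IsFiniteMeasure (∑ a, r a • Measure.dirac (x a)) := by
    constructor
    simp only [Measure.coe_finsetSum, Finset.sum_apply, Measure.smul_apply, smul_eq_mul,
      measure_univ, mul_one]
    exact lt_of_le_of_lt hr ENNReal.one_lt_top
  apply Measure.pi_eq
  intro s hs
  simp only [Measure.coe_finsetSum, Finset.sum_apply, Measure.smul_apply, smul_eq_mul]
  rw [Finset.prod_univ_sum, Fintype.piFinset_univ]
  refine Finset.sum_congr rfl fun i _ => ?_
  rw [Finset.prod_mul_distrib]
  congr 1
  rw [Measure.dirac_apply' _ (MeasurableSet.univ_pi hs)]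
  simp_rw [Measure.dirac_apply' _ (hs _)]
  by_cases h : ∀ j, x (i j) ∈ s j
  · rw [Set.indicator_of_mem (by simpa using h)]
    rw [Finset.prod_eq_one]
    · rfl
    · intro j _
      rw [Set.indicator_of_mem (h j)]; rfl
  · rw [Set.indicator_of_notMem (by simpa using h)]
    push Not at h
    obtain ⟨j, hj⟩ := h
    rw [Finset.prod_eq_zero (Finset.mem_univ j)]
    rw [Set.indicator_of_notMem hj]

lemma aux_bind {A B : Type*} [MeasurableSpace A] [MeasurableSpace B] {k : ℕ} (m : ℕ)
    (x : Fin k → A) (r : Fin k → ℝ≥0∞)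
    (hr : ∑ i, r i ≤ 1) (κ : (Fin m → A) → Measure B) (hκ : Measurable κ) {S : Set B}
    (hS : MeasurableSet S) :
    ((Measure.pi fun _ : Fin m => (∑ a, r a • Measure.dirac (x a))).bind κ) S =
      ∑ i : Fin m → Fin k, (∏ j, r (i j)) * κ (x ∘ i) S := by
  rw [Measure.bind_apply hS hκ.aemeasurable, aux_pi m x r hr, lintegral_finsetSum_measure]
  refine Finset.sum_congr rfl fun i _ => ?_
  rw [lintegral_smul_measure, lintegral_dirac' (f := fun a => κ a S) _ ((Measure.measurable_coe hS).comp hκ)]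
  rfl

lemma aux_series_real (d : ℕ → ℝ) (hd : ∀ m, |d m| ≤ 1)
    (h : ∀ t : ℝ, 0 < t → t < 1 → ∑' m, d m * t ^ m = 0) : ∀ m, d m = 0 := by
  have hsum : ∀ (k : ℕ) (t : ℝ), 0 < t → t < 1 → Summable fun m => d (m + k) * t ^ m := by
    intro k t h0 h1
    refine Summable.of_norm_bounded (summable_geometric_of_lt_one h0.le h1) fun m => ?_
    rw [Real.norm_eq_abs, abs_mul, abs_of_pos (pow_pos h0 m)]
    exact mul_le_of_le_one_left (pow_pos h0 m).le (hd _)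
  have step : ∀ k, (∀ t : ℝ, 0 < t → t < 1 → ∑' m, d (m + k) * t ^ m = 0) →
      d k = 0 ∧ (∀ t : ℝ, 0 < t → t < 1 → ∑' m, d (m + (k + 1)) * t ^ m = 0) := by
    intro k hk
    have e : ∀ t : ℝ, 0 < t → t < 1 → d k + t * ∑' m, d (m + (k + 1)) * t ^ m = 0 := by
      intro t h0 h1
      have := hk t h0 h1
      rw [(hsum k t h0 h1).tsum_eq_zero_add] at this
      rw [← tsum_mul_left, ← this]
      simp only [zero_add, pow_zero, mul_one]
      congr 1
      refine tsum_congr fun m => ?_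
      rw [show m + 1 + k = m + (k + 1) by ring]
      ring
    have hz : d k = 0 := by
      by_contra hne
      have hp : 0 < |d k| := abs_pos.mpr hne
      set t := |d k| / 4 with ht
      have h0 : 0 < t := by positivity
      have h1 : t ≤ 1 / 2 := by have := hd k; linarith
      have hb : |∑' m, d (m + (k + 1)) * t ^ m| ≤ (1 - t)⁻¹ := by
        rw [← Real.norm_eq_abs]
        refine tsum_of_norm_bounded (hasSum_geometric_of_lt_one h0.le (by linarith)) fun m => ?_
        rw [Real.norm_eq_abs, abs_mul, abs_of_pos (pow_pos h0 m)]
        exact mul_le_of_le_one_left (pow_pos h0 m).le (hd _)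
      have hb2 : (1 - t)⁻¹ ≤ 2 := by
        rw [inv_le_comm₀ (by linarith) (by norm_num)]; linarith
      have := e t h0 (by linarith)
      have h3 : |d k| = t * |∑' m, d (m + (k + 1)) * t ^ m| := by
        rw [eq_neg_of_add_eq_zero_left this, abs_neg, abs_mul, abs_of_pos h0]
      have h4 : |d k| ≤ t * 2 := by
        rw [h3]; exact mul_le_mul_of_nonneg_left (hb.trans hb2) h0.le
      linarith
    refine ⟨hz, fun t h0 h1 => ?_⟩
    have := e t h0 h1
    rw [hz, zero_add] at this
    exact (mul_eq_zero.mp this).resolve_left h0.ne'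
  have all : ∀ k, (∀ t : ℝ, 0 < t → t < 1 → ∑' m, d (m + k) * t ^ m = 0) := by
    intro k
    induction k with
    | zero => simpa using h
    | succ k ih => exact (step k ih).2
  exact fun m => (step m (all m)).1

lemma aux_series (a b : ℕ → ℝ≥0∞) (ha : ∀ m, a m ≤ 1) (hb : ∀ m, b m ≤ 1)
    (h : ∀ t : ℝ, 0 < t → t < 1 → ∑' m, a m * ENNReal.ofReal t ^ m =
      ∑' m, b m * ENNReal.ofReal t ^ m) : ∀ m, a m = b m := by
  have fin : ∀ (c : ℕ → ℝ≥0∞), (∀ m, c m ≤ 1) → ∀ m, c m ≠ ⊤ := fun c hc m =>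
    ne_top_of_le_ne_top ENNReal.one_ne_top (hc m)
  have hle : ∀ (c : ℕ → ℝ≥0∞), (∀ m, c m ≤ 1) → ∀ m, (c m).toReal ≤ 1 := fun c hc m => by
    simpa using ENNReal.toReal_mono ENNReal.one_ne_top (hc m)
  have conv : ∀ (c : ℕ → ℝ≥0∞), (∀ m, c m ≤ 1) → ∀ t : ℝ, 0 < t → t < 1 →
      (∑' m, c m * ENNReal.ofReal t ^ m).toReal = ∑' m, (c m).toReal * t ^ m := by
    intro c hc t h0 h1
    rw [ENNReal.tsum_toReal_eq]
    · refine tsum_congr fun m => ?_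
      rw [ENNReal.toReal_mul, ENNReal.toReal_pow, ENNReal.toReal_ofReal h0.le]
    · intro m
      exact ENNReal.mul_ne_top (fin c hc m) (ENNReal.pow_ne_top ENNReal.ofReal_ne_top)
  have sm : ∀ (c : ℕ → ℝ≥0∞), (∀ m, c m ≤ 1) → ∀ t : ℝ, 0 < t → t < 1 →
      Summable fun m => (c m).toReal * t ^ m := by
    intro c hc t h0 h1
    refine Summable.of_nonneg_of_le (fun m => by positivity) (fun m => ?_)
      (summable_geometric_of_lt_one h0.le h1)
    exact mul_le_of_le_one_left (pow_pos h0 m).le (hle c hc m)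
  have key := aux_series_real (fun m => (a m).toReal - (b m).toReal) (fun m => by
      have h1 := hle a ha m
      have h2 := hle b hb m
      have h3 : 0 ≤ (a m).toReal := ENNReal.toReal_nonneg
      have h4 : 0 ≤ (b m).toReal := ENNReal.toReal_nonneg
      rw [abs_le]; constructor <;> linarith) (fun t h0 h1 => by
      simp only [sub_mul]
      rw [(sm a ha t h0 h1).tsum_sub (sm b hb t h0 h1), ← conv a ha t h0 h1, ← conv b hb t h0 h1,
        h t h0 h1, sub_self])
  intro m
  exact (ENNReal.toReal_eq_toReal_iff' (fin a ha m) (fin b hb m)).mp (sub_eq_zero.mp (key m))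

/-- Inclusion-exclusion for symmetric coefficients. -/
lemma aux_polar (n : ℕ) (s : ℝ) (c : (Fin n → Fin n) → ℝ)
    (hc : ∀ σ : Equiv.Perm (Fin n), c σ = c id) :
    ∑ T : Finset (Fin n), (-1 : ℝ) ^ T.card *
      ∑ i : Fin n → Fin n, (∏ j, (if i j ∈ T then 0 else s)) * c i =
      s ^ n * (n.factorial : ℝ) * c id := by
  classical
  have h1 : ∀ i : Fin n → Fin n,
      ∑ T : Finset (Fin n), (-1 : ℝ) ^ T.card * (∏ j, (if i j ∈ T then 0 else s)) =
        if Function.Bijective i then s ^ n else 0 := by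
    intro i
    have hp := Finset.prod_add (fun a : Fin n => if a ∈ Set.range i then (0 : ℝ) else -1)
      (fun _ => (1 : ℝ)) Finset.univ
    have e : ∀ T : Finset (Fin n), (-1 : ℝ) ^ T.card * (∏ j, (if i j ∈ T then 0 else s)) =
       s ^ n * ((∏ a ∈ T, (if a ∈ Set.range i then (0 : ℝ) else -1)) *
         ∏ _a ∈ Finset.univ \ T, (1 : ℝ)) := by
      intro T
      rw [Finset.prod_const_one, mul_one]
      by_cases h : ∃ j, i j ∈ T
      · obtain ⟨j, hj⟩ := h
        rw [Finset.prod_eq_zero (Finset.mem_univ j) (by simp [hj]),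
          Finset.prod_eq_zero hj (by simp)]
        simp
      · push Not at h
        have e1 : ∏ j, (if i j ∈ T then 0 else s) = s ^ n := by
          rw [Finset.prod_congr rfl (fun j _ => if_neg (h j))]
          simp
        have e2 : ∏ a ∈ T, (if a ∈ Set.range i then (0 : ℝ) else -1) = (-1) ^ T.card := by
          rw [← Finset.prod_const]
          refine Finset.prod_congr rfl fun a ha => if_neg ?_
          rintro ⟨j, rfl⟩
          exact h j ha
        rw [e1, e2, mul_comm]
    rw [Finset.sum_congr rfl (fun T _ => e T), ← Finset.mul_sum]
    rw [Finset.powerset_univ] at hp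
    rw [← hp]
    split_ifs with hb
    · rw [Finset.prod_eq_one, mul_one]
      intro a _
      rw [if_pos (Set.mem_range.mpr (hb.surjective a)), zero_add]
    · have hs : ¬ Function.Surjective i := fun h => hb (Finite.surjective_iff_bijective.mp h)
      rw [Function.Surjective] at hs
      push Not at hs
      obtain ⟨a, ha⟩ := hs
      rw [Finset.prod_eq_zero (Finset.mem_univ a), mul_zero]
      rw [if_neg (by rintro ⟨j, hj⟩; exact ha j hj)]
      norm_num
  simp only [Finset.mul_sum]
  rw [Finset.sum_comm]
  simp only [← mul_assoc, ← Finset.sum_mul, h1]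
  simp only [ite_mul, zero_mul]
  rw [← Finset.sum_filter]
  have h2 : ∑ i ∈ Finset.univ.filter (fun i : Fin n → Fin n => Function.Bijective i),
      s ^ n * c i = ∑ σ : Equiv.Perm (Fin n), s ^ n * c σ := by
    symm
    refine Finset.sum_bij (fun σ _ => (σ : Fin n → Fin n)) ?_ ?_ ?_ ?_
    · intro σ _
      exact Finset.mem_filter.mpr ⟨Finset.mem_univ _, σ.bijective⟩
    · intro σ _ τ _ h
      exact DFunLike.coe_injective h
    · intro i hi
      exact ⟨Equiv.ofBijective i (Finset.mem_filter.mp hi).2, Finset.mem_univ _, rfl⟩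
    · intro σ _
      rfl
  rw [h2]
  simp only [hc, Finset.sum_const, Finset.card_univ, Fintype.card_perm, Fintype.card_fin,
    nsmul_eq_mul]
  ring

theorem stmt_11 {A B : Type*} [MeasurableSpace A] [MeasurableSpace B]
    (κ lam : (n : ℕ) → (Fin n → A) → Measure B)
    (hκm : ∀ n, Measurable (κ n)) (hκ1 : ∀ n x, κ n x Set.univ ≤ 1)
    (hlamm : ∀ n, Measurable (lam n)) (hlam1 : ∀ n x, lam n x Set.univ ≤ 1)
    (hκsym : ∀ (n : ℕ) (x : Fin n → A) (σ : Equiv.Perm (Fin n)), κ n (x ∘ σ) = κ n x)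
    (hlamsym : ∀ (n : ℕ) (x : Fin n → A) (σ : Equiv.Perm (Fin n)), lam n (x ∘ σ) = lam n x)
    (heq : ∀ μ : Measure A, IsFinitelySupportedSubProb μ →
      (Measure.sum fun n => (Measure.pi fun _ : Fin n => μ).bind (κ n)) Set.univ ≤ 1 ∧
      (Measure.sum fun n => (Measure.pi fun _ : Fin n => μ).bind (lam n)) Set.univ ≤ 1 ∧
      (Measure.sum fun n => (Measure.pi fun _ : Fin n => μ).bind (κ n)) =
        Measure.sum fun n => (Measure.pi fun _ : Fin n => μ).bind (lam n)) :
    ∀ (n : ℕ) (x : Fin n → A), κ n x = lam n x := by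
  classical
  intro n x
  ext S hS
  -- equality of homogeneous parts
  have hom : ∀ r : Fin n → ℝ≥0∞, ∑ a, r a ≤ 1 → ∀ m,
      ∑ i : Fin m → Fin n, (∏ j, r (i j)) * κ m (x ∘ i) S =
      ∑ i : Fin m → Fin n, (∏ j, r (i j)) * lam m (x ∘ i) S := by
    intro r hr
    obtain ⟨hk, hl, -⟩ := heq _ ⟨n, x, r, hr, rfl⟩
    have bd : ∀ (θ : (n : ℕ) → (Fin n → A) → Measure B), (∀ n, Measurable (θ n)) →
        (Measure.sum fun m => (Measure.pi fun _ : Fin m =>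
          (∑ a, r a • Measure.dirac (x a))).bind (θ m)) Set.univ ≤ 1 →
        ∀ m, ∑ i : Fin m → Fin n, (∏ j, r (i j)) * θ m (x ∘ i) S ≤ 1 := by
      intro θ hθ h m
      rw [← aux_bind m x r hr (θ m) (hθ m) hS]
      refine le_trans ?_ h
      refine (measure_mono (Set.subset_univ S)).trans ?_
      exact Measure.le_sum (fun m => (Measure.pi fun _ : Fin m =>
          (∑ a, r a • Measure.dirac (x a))).bind (θ m)) m Set.univ
    apply aux_series _ _ (bd κ hκm hk) (bd lam hlamm hl)
    intro t h0 h1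
    have hr' : ∑ a, (ENNReal.ofReal t * r a) ≤ 1 := by
      rw [← Finset.mul_sum]
      exact mul_le_one' (by simpa using h1.le) hr
    have E := congrArg (fun ν : Measure B => ν S) (heq _ ⟨n, x, _, hr', rfl⟩).2.2
    simp only [Measure.sum_apply _ hS] at E
    have cv : ∀ (θ : (n : ℕ) → (Fin n → A) → Measure B), (∀ n, Measurable (θ n)) → ∀ m,
        ((Measure.pi fun _ : Fin m =>
          (∑ a, (ENNReal.ofReal t * r a) • Measure.dirac (x a))).bind (θ m)) S =
        (∑ i : Fin m → Fin n, (∏ j, r (i j)) * θ m (x ∘ i) S) * ENNReal.ofReal t ^ m := by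
      intro θ hθ m
      rw [aux_bind m x _ hr' (θ m) (hθ m) hS, Finset.sum_mul]
      refine Finset.sum_congr rfl fun i _ => ?_
      rw [Finset.prod_mul_distrib, Finset.prod_const, Finset.card_univ, Fintype.card_fin]
      ring
    simpa only [cv κ hκm, cv lam hlamm] using E
  have fk : ∀ (y : Fin n → A), κ n y S ≠ ⊤ := fun y =>
    ne_top_of_le_ne_top ENNReal.one_ne_top ((measure_mono (Set.subset_univ S)).trans (hκ1 n y))
  have fl : ∀ (y : Fin n → A), lam n y S ≠ ⊤ := fun y =>
    ne_top_of_le_ne_top ENNReal.one_ne_top ((measure_mono (Set.subset_univ S)).trans (hlam1 n y))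
  set s : ℝ := ((n : ℝ) + 1)⁻¹ with hs
  have hs0 : 0 < s := by positivity
  have homR : ∀ T : Finset (Fin n),
      ∑ i : Fin n → Fin n, (∏ j, (if i j ∈ T then 0 else s)) * (κ n (x ∘ i) S).toReal =
      ∑ i : Fin n → Fin n, (∏ j, (if i j ∈ T then 0 else s)) * (lam n (x ∘ i) S).toReal := by
    intro T
    have hr : ∑ a : Fin n, ENNReal.ofReal (if a ∈ T then 0 else s) ≤ 1 := by
      rw [← ENNReal.ofReal_sum_of_nonneg (fun a _ => by split_ifs <;> positivity)]
      rw [ENNReal.ofReal_le_one]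
      calc ∑ a : Fin n, (if a ∈ T then 0 else s) ≤ ∑ a : Fin n, s :=
            Finset.sum_le_sum fun a _ => by split_ifs <;> linarith
        _ = n * s := by simp
        _ ≤ 1 := by
          rw [hs, ← div_eq_mul_inv, div_le_one (by positivity)]; linarith
    have := congrArg ENNReal.toReal (hom _ hr n)
    have cv : ∀ (θ : (Fin n → A) → Measure B), (∀ y, θ y S ≠ ⊤) →
        (∑ i : Fin n → Fin n, (∏ j, ENNReal.ofReal (if i j ∈ T then 0 else s)) *
          θ (x ∘ i) S).toReal =
        ∑ i : Fin n → Fin n, (∏ j, (if i j ∈ T then 0 else s)) * (θ (x ∘ i) S).toReal := by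
      intro θ hθ
      rw [ENNReal.toReal_sum]
      · refine Finset.sum_congr rfl fun i _ => ?_
        rw [ENNReal.toReal_mul, ENNReal.toReal_prod]
        congr 1
        refine Finset.prod_congr rfl fun j _ => ?_
        rw [ENNReal.toReal_ofReal (by split_ifs <;> positivity)]
      · intro i _
        exact ENNReal.mul_ne_top (ENNReal.prod_ne_top fun j _ => ENNReal.ofReal_ne_top) (hθ _)
    rwa [cv _ fk, cv _ fl] at this
  have p1 := aux_polar n s (fun i => (κ n (x ∘ i) S).toReal) (fun σ => by
    simp only [hκsym, Function.comp_id])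
  have p2 := aux_polar n s (fun i => (lam n (x ∘ i) S).toReal) (fun σ => by
    simp only [hlamsym, Function.comp_id])
  simp only [homR] at p1
  have p3 := p1.symm.trans p2
  have hne : s ^ n * (n.factorial : ℝ) ≠ 0 := by
    have := Nat.factorial_ne_zero n
    have : (n.factorial : ℝ) ≠ 0 := by exact_mod_cast this
    exact mul_ne_zero (pow_ne_zero _ hs0.ne') this
  have p4 := mul_left_cancel₀ hne p3
  simp only [Function.comp_id] at p4
  exact (ENNReal.toReal_eq_toReal_iff' (fk x) (fl x)).mp p4
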